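/- arXiv:1705.05184 — 5 statements merged into one kernel-verified Lean document; each statement's English description precedes it below -/
import Mathlib

section
/- Let θ ∈ (0,1). The second derivative of the function f_θ(h) = arctanh(θ · tanh(h)) satisfies f_θ''(x) < 0 for all x > 0; in particular f_θ is strictly concave on (0,∞). -/
/-- Inverse hyperbolic tangent. -/
noncomputable def artanh (x : ℝ) : ℝ := (1 / 2) * Real.log ((1 + x) / (1 - x))

/-- The function `f_θ(h) = arctanh(θ · tanh h)`. -/
noncomputable def isingF (θ h : ℝ) : ℝ := artanh (θ * Real.tanh h)

theorem isingF_pos (θ : ℝ) (hθ : θ ∈ Set.Ioo (0 : ℝ) 1) (x : ℝ) :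
    0 < Real.cosh x + θ * Real.sinh x ∧ 0 < Real.cosh x - θ * Real.sinh x := by
  obtain ⟨h0, h1⟩ := hθ
  have hc := Real.cosh_pos x
  have ha : 0 < Real.cosh x + Real.sinh x := by
    rw [Real.cosh_add_sinh]; exact Real.exp_pos x
  have hb : 0 < Real.cosh x - Real.sinh x := by
    rw [Real.cosh_sub_sinh]; exact Real.exp_pos (-x)
  constructor <;> nlinarith [mul_pos h0 ha, mul_pos h0 hb, mul_pos (sub_pos.2 h1) hc]

theorem isingF_eq (θ : ℝ) (hθ : θ ∈ Set.Ioo (0 : ℝ) 1) :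
    isingF θ = fun x => (1 / 2) * (Real.log (Real.cosh x + θ * Real.sinh x)
      - Real.log (Real.cosh x - θ * Real.sinh x)) := by
  funext x
  obtain ⟨ha, hb⟩ := isingF_pos θ hθ x
  have hc := Real.cosh_pos x
  rw [← Real.log_div ha.ne' hb.ne', isingF, artanh, Real.tanh_eq_sinh_div_cosh]
  congr 2
  have e1 : 1 + θ * (Real.sinh x / Real.cosh x)
      = (Real.cosh x + θ * Real.sinh x) / Real.cosh x := by field_simp
  have e2 : 1 - θ * (Real.sinh x / Real.cosh x)
      = (Real.cosh x - θ * Real.sinh x) / Real.cosh x := by field_simp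
  rw [e1, e2, div_div_div_cancel_right₀ hc.ne']

theorem isingF_hasDerivAt (θ : ℝ) (hθ : θ ∈ Set.Ioo (0 : ℝ) 1) (x : ℝ) :
    HasDerivAt (isingF θ) (θ / (Real.cosh x ^ 2 - θ ^ 2 * Real.sinh x ^ 2)) x := by
  obtain ⟨ha, hb⟩ := isingF_pos θ hθ x
  rw [isingF_eq θ hθ]
  have hs := (Real.hasDerivAt_sinh x).const_mul θ
  have h := ((((Real.hasDerivAt_cosh x).add hs).log ha.ne').sub
    (((Real.hasDerivAt_cosh x).sub hs).log hb.ne')).const_mul (1 / 2 : ℝ)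
  refine h.congr_deriv ?_
  have e : Real.cosh x ^ 2 - θ ^ 2 * Real.sinh x ^ 2
    = (Real.cosh x + θ * Real.sinh x) * (Real.cosh x - θ * Real.sinh x) := by ring
  have hq := Real.cosh_sq x
  simp only [Pi.add_apply, Pi.sub_apply]
  rw [e, div_sub_div _ _ ha.ne' hb.ne', mul_div_assoc']
  congr 1
  linear_combination θ * hq

theorem isingF_deriv2 (θ : ℝ) (hθ : θ ∈ Set.Ioo (0 : ℝ) 1) (x : ℝ) (hx : 0 < x) :
    deriv (deriv (isingF θ)) x < 0 := by
  have e : deriv (isingF θ) = fun x => θ / (Real.cosh x ^ 2 - θ ^ 2 * Real.sinh x ^ 2) :=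
    funext fun y => (isingF_hasDerivAt θ hθ y).deriv
  obtain ⟨ha, hb⟩ := isingF_pos θ hθ x
  have hD : 0 < Real.cosh x ^ 2 - θ ^ 2 * Real.sinh x ^ 2 := by nlinarith [mul_pos ha hb]
  have h := (hasDerivAt_const x θ).fun_div (((Real.hasDerivAt_cosh x).fun_pow 2).fun_sub
    (((Real.hasDerivAt_sinh x).fun_pow 2).const_mul (θ ^ 2))) hD.ne'
  rw [e, h.deriv]
  apply div_neg_of_neg_of_pos _ (by positivity)
  have hs : 0 < Real.sinh x := Real.sinh_pos_iff.2 hx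
  have hc := Real.cosh_pos x
  have h2 : 0 < 1 - θ ^ 2 := by nlinarith [hθ.1, hθ.2]
  have := mul_pos (mul_pos hθ.1 h2) (mul_pos hs hc)
  norm_num
  nlinarith

/-- For `θ ∈ (0,1)`: the second derivative of `f_θ` is negative on `(0,∞)`; in
particular `f_θ` is strictly concave on `(0,∞)`. -/
theorem isingF_second_deriv_neg (θ : ℝ) (hθ : θ ∈ Set.Ioo (0 : ℝ) 1) :
    (∀ x : ℝ, 0 < x → deriv (deriv (isingF θ)) x < 0) ∧
    StrictConcaveOn ℝ (Set.Ioi (0 : ℝ)) (isingF θ) := by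
  refine ⟨isingF_deriv2 θ hθ, ?_⟩
  apply strictConcaveOn_of_deriv2_neg' (convex_Ioi 0)
  · exact fun x _ => (isingF_hasDerivAt θ hθ x).continuousAt.continuousWithinAt
  · exact fun x hx => isingF_deriv2 θ hθ x hx
end

section
/- Let θ ∈ (−1,1) and a, b, c, d ∈ ℝ with b ≠ 0. Define φ(h) = (1/b)·[(b·c − a·d)·f_θ(h) + d·h] and ψ(h) = a·f_θ(h) + b·f_θ(φ(h)). Then a pair (h,l) ∈ ℝ² solves the system h = a·f_θ(h) + b·f_θ(l), l = c·f_θ(h) + d·f_θ(l) if and only if l = φ(h) and h = ψ(h). Moreover, ψ(0) = 0 and ψ is differentiable at 0 with ψ'(0) = θ·((b·c − a·d)·θ + a + d). -/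
theorem isingF_zero (θ : ℝ) : isingF θ 0 = 0 := by
  simp [isingF, artanh]

theorem isingF_hasDerivAt_s9 (θ : ℝ) : HasDerivAt (isingF θ) θ 0 := by
  have ht : HasDerivAt Real.tanh 1 0 := by
    have h := (Real.hasDerivAt_sinh 0).div (Real.hasDerivAt_cosh 0) (Real.cosh_pos 0).ne'
    have e : Real.tanh = Real.sinh / Real.cosh := by
      funext x
      simp [Real.tanh_eq_sinh_div_cosh]
    rw [e]
    simpa using h
  have hm : HasDerivAt (fun x => θ * Real.tanh x) θ 0 := by
    simpa using ht.const_mul θ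
  have hq := (hm.const_add 1).div (hm.const_sub 1) (by simp)
  have hl := (hq.log (by simp)).const_mul (1 / 2)
  have := hl.congr_deriv (g' := θ) (by simp; ring)
  exact this

/-- For `b ≠ 0`, with `φ(h) = (1/b)((bc − ad) f_θ(h) + dh)` and
`ψ(h) = a f_θ(h) + b f_θ(φ(h))`: `(h,l)` solves the system iff `l = φ(h)` and
`h = ψ(h)`; moreover `ψ(0) = 0` and `ψ'(0) = θ((bc − ad)θ + a + d)`. -/
theorem system_reduction_to_psi (θ a b c d : ℝ) (hθ : θ ∈ Set.Ioo (-1 : ℝ) 1)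
    (hb : b ≠ 0) (φ ψ : ℝ → ℝ)
    (hφ : ∀ h : ℝ, φ h = (1 / b) * ((b * c - a * d) * isingF θ h + d * h))
    (hψ : ∀ h : ℝ, ψ h = a * isingF θ h + b * isingF θ (φ h)) :
    (∀ h l : ℝ,
      (h = a * isingF θ h + b * isingF θ l ∧ l = c * isingF θ h + d * isingF θ l) ↔
      (l = φ h ∧ h = ψ h)) ∧
    ψ 0 = 0 ∧
    HasDerivAt ψ (θ * ((b * c - a * d) * θ + a + d)) 0 := by
  have h0 : φ 0 = 0 := by rw [hφ, isingF_zero]; simp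
  refine ⟨?_, ?_, ?_⟩
  · intro h l
    constructor
    · rintro ⟨h1, h2⟩
      have hl : l = φ h := by
        rw [hφ]
        field_simp
        linear_combination b * h2 - d * h1
      refine ⟨hl, ?_⟩
      rw [hψ, ← hl]
      exact h1
    · rintro ⟨h1, h2⟩
      rw [hψ, ← h1] at h2
      refine ⟨h2, ?_⟩
      rw [hφ] at h1
      field_simp at h1
      apply mul_left_cancel₀ hb
      linear_combination h1 + d * h2
  · rw [hψ, h0, isingF_zero]; simp
  · have hf := isingF_hasDerivAt_s9 θ
    have hφ' : HasDerivAt φ ((1 / b) * ((b * c - a * d) * θ + d * 1)) 0 := by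
      rw [funext hφ]
      exact ((hf.const_mul _).add ((hasDerivAt_id 0).const_mul d)).const_mul _
    have hf2 : HasDerivAt (isingF θ) θ (φ 0) := by rw [h0]; exact hf
    rw [funext hψ]
    refine ((hf.const_mul a).add ((hf2.comp 0 hφ').const_mul b)).congr_deriv ?_
    field_simp
    ring
end

section
/- Let θ ∈ (0,1) and let a ≥ 1, d ≥ 1 and c be real numbers with θ > 1/a and θ > 1/d. Let h₀ > 0 be the unique positive solution of h = a·f_θ(h), let l₀ > 0 be the unique positive solution of l = d·f_θ(l), and set h̄ = sup_{l ≥ 0} (d·f_θ(l) − l). If |c/a|·h₀ < h̄, then the system h = a·f_θ(h), l = c·f_θ(h) + d·f_θ(l) has at least nine distinct solutions: (0,0), (0, l₀), (0, −l₀), and for each sign ε ∈ {+1,−1} three distinct solutions (ε·h₀, l) where l runs over the three distinct solutions of l = ε·(c/a)·h₀ + d·f_θ(l). -/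
theorem isingF_neg (θ h : ℝ) : isingF θ (-h) = -isingF θ h := by
  unfold isingF artanh
  rw [Real.tanh_neg]
  have : (1 + θ * -Real.tanh h) / (1 - θ * -Real.tanh h)
      = ((1 + θ * Real.tanh h) / (1 - θ * Real.tanh h))⁻¹ := by
    rw [inv_div]; congr 1 <;> ring
  rw [this, Real.log_inv]; ring

theorem theta_tanh_bound {θ : ℝ} (hθ : θ ∈ Set.Ioo (0 : ℝ) 1) (h : ℝ) :
    -θ < θ * Real.tanh h ∧ θ * Real.tanh h < θ := by
  have h1 := Real.tanh_lt_one h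
  have h2 := Real.neg_one_lt_tanh h
  constructor <;> nlinarith [hθ.1]

theorem isingF_le {θ : ℝ} (hθ : θ ∈ Set.Ioo (0 : ℝ) 1) (h : ℝ) :
    isingF θ h ≤ artanh θ := by
  obtain ⟨h1, h2⟩ := theta_tanh_bound hθ h
  obtain ⟨h3, h4⟩ := hθ
  unfold isingF artanh
  have : Real.log ((1 + θ * Real.tanh h) / (1 - θ * Real.tanh h))
      ≤ Real.log ((1 + θ) / (1 - θ)) := by
    apply Real.log_le_log
    · apply div_pos <;> linarith
    · apply div_le_div₀ <;> linarith
  linarith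

theorem isingF_continuous {θ : ℝ} (hθ : θ ∈ Set.Ioo (0 : ℝ) 1) :
    Continuous (isingF θ) := by
  have ht : Continuous Real.tanh := by
    have : Real.tanh = fun x => Real.sinh x / Real.cosh x := by
      funext x; exact Real.tanh_eq_sinh_div_cosh x
    rw [this]
    exact Real.continuous_sinh.div Real.continuous_cosh (fun x => (Real.cosh_pos x).ne')
  have h3 := hθ.1
  have h4 := hθ.2
  unfold isingF artanh
  refine continuous_const.mul (Continuous.log ?_ ?_)
  · refine Continuous.div (by fun_prop) (by fun_prop) ?_
    intro x
    obtain ⟨h1, h2⟩ := theta_tanh_bound hθ x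
    linarith
  · intro x
    obtain ⟨h1, h2⟩ := theta_tanh_bound hθ x
    apply ne_of_gt
    apply div_pos <;> linarith

theorem three_roots {θ d m k : ℝ} (hθ : θ ∈ Set.Ioo (0 : ℝ) 1) (hd : 1 ≤ d)
    (hm : 0 < m) (hk : |k| < d * isingF θ m - m) :
    ∃ x y z : ℝ, x < y ∧ y < z ∧
      ∀ l ∈ ({x, y, z} : Set ℝ), l = k + d * isingF θ l := by
  obtain ⟨hk1, hk2⟩ := abs_lt.1 hk
  have hcont : Continuous (fun l => d * isingF θ l - l) :=
    ((isingF_continuous hθ).const_mul d).sub continuous_id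
  obtain ⟨M, hM⟩ : ∃ M, M = m + d * artanh θ + |k| + 1 := ⟨_, rfl⟩
  have hk0 := le_abs_self k
  have hk0n := neg_abs_le k
  have hb : d * isingF θ M ≤ d * artanh θ :=
    mul_le_mul_of_nonneg_left (isingF_le hθ M) (by linarith)
  have hbm : d * isingF θ m ≤ d * artanh θ :=
    mul_le_mul_of_nonneg_left (isingF_le hθ m) (by linarith)
  have hmM : m < M := by linarith [abs_nonneg k]
  obtain ⟨x, hx, hxe⟩ := intermediate_value_Ioo' (a := -M) (b := -m) (by linarith)
    hcont.continuousOn (show -k ∈ Set.Ioo _ _ by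
      simp only [isingF_neg]; constructor <;> linarith)
  obtain ⟨y, hy, hye⟩ := intermediate_value_Ioo (a := -m) (b := m) (by linarith)
    hcont.continuousOn (show -k ∈ Set.Ioo _ _ by
      simp only [isingF_neg]; constructor <;> linarith)
  obtain ⟨z, hz, hze⟩ := intermediate_value_Ioo' (a := m) (b := M) (by linarith)
    hcont.continuousOn (show -k ∈ Set.Ioo _ _ by
      constructor <;> linarith)
  refine ⟨x, y, z, hx.2.trans hy.1, hy.2.trans hz.1, ?_⟩
  simp only at hxe hye hze
  rintro l (rfl | rfl | rfl) <;> linarith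

/-- Case `b = 0`: if `θ > 1/a`, `θ > 1/d`, and `|c/a|·h₀ < h̄`, then the system
`h = a f_θ(h)`, `l = c f_θ(h) + d f_θ(l)` has at least nine distinct solutions:
`(0,0)`, `(0, ±l₀)` and, for each sign `ε`, three solutions `(ε h₀, l)` with `l` among
the three distinct solutions of `l = ε (c/a) h₀ + d f_θ(l)`. -/
theorem system_b_zero_nine_solutions (θ a c d h₀ l₀ : ℝ)
    (hθ : θ ∈ Set.Ioo (0 : ℝ) 1) (ha : 1 ≤ a) (hd : 1 ≤ d)
    (hθa : θ > 1 / a) (hθd : θ > 1 / d)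
    (hh₀pos : 0 < h₀) (hh₀eq : h₀ = a * isingF θ h₀)
    (hh₀uniq : ∀ h : ℝ, 0 < h → h = a * isingF θ h → h = h₀)
    (hl₀pos : 0 < l₀) (hl₀eq : l₀ = d * isingF θ l₀)
    (hl₀uniq : ∀ l : ℝ, 0 < l → l = d * isingF θ l → l = l₀)
    (hbar : ℝ) (hhbar : hbar = sSup ((fun l => d * isingF θ l - l) '' Set.Ici (0 : ℝ)))
    (hlt : |c / a| * h₀ < hbar) :
    ∃ lp₁ lp₂ lp₃ lm₁ lm₂ lm₃ : ℝ,
      lp₁ < lp₂ ∧ lp₂ < lp₃ ∧ lm₁ < lm₂ ∧ lm₂ < lm₃ ∧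
      (∀ l ∈ ({lp₁, lp₂, lp₃} : Set ℝ), l = (c / a) * h₀ + d * isingF θ l) ∧
      (∀ l ∈ ({lm₁, lm₂, lm₃} : Set ℝ), l = -((c / a) * h₀) + d * isingF θ l) ∧
      ((0 : ℝ) = a * isingF θ 0 ∧ (0 : ℝ) = c * isingF θ 0 + d * isingF θ 0) ∧
      (l₀ = c * isingF θ 0 + d * isingF θ l₀) ∧
      (-l₀ = c * isingF θ 0 + d * isingF θ (-l₀)) ∧
      (h₀ = a * isingF θ h₀ ∧
        ∀ l ∈ ({lp₁, lp₂, lp₃} : Set ℝ), l = c * isingF θ h₀ + d * isingF θ l) ∧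
      (-h₀ = a * isingF θ (-h₀) ∧
        ∀ l ∈ ({lm₁, lm₂, lm₃} : Set ℝ), l = c * isingF θ (-h₀) + d * isingF θ l) := by
  have ha0 : a ≠ 0 := by linarith
  have hk : |c / a * h₀| < hbar := by rwa [abs_mul, abs_of_pos hh₀pos]
  rw [hhbar] at hk
  obtain ⟨_, ⟨m, hm, rfl⟩, hkm⟩ := exists_lt_of_lt_csSup
    (Set.Nonempty.image _ ⟨0, Set.self_mem_Ici⟩) hk
  simp only at hkm
  have hm0 : 0 < m := by
    rcases (show (0 : ℝ) ≤ m from hm).lt_or_eq with h | h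
    · exact h
    · rw [← h, isingF_zero] at hkm
      linarith [abs_nonneg (c / a * h₀)]
  obtain ⟨x, y, z, hxy, hyz, hp⟩ := three_roots hθ hd hm0 hkm
  obtain ⟨xn, yn, zn, hxyn, hyzn, hpn⟩ := three_roots (k := -(c / a * h₀)) hθ hd hm0
    (by rwa [abs_neg])
  have hc : c * isingF θ h₀ = c / a * h₀ := by
    conv_rhs => rw [hh₀eq]
    field_simp
  refine ⟨x, y, z, xn, yn, zn, hxy, hyz, hxyn, hyzn, hp, hpn, ?_, ?_, ?_, ⟨hh₀eq, ?_⟩, ?_, ?_⟩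
  · simp [isingF_zero]
  · rw [isingF_zero]; linarith
  · rw [isingF_zero, isingF_neg]; linarith
  · rw [hc]; exact hp
  · rw [isingF_neg]; linarith
  · rw [isingF_neg, mul_neg, hc]; exact hpn
end

section
/- Let β > 0, J > 0, k ≥ 2 an integer, θ = tanh(β·J), and suppose θ > 1/k. Let h₀ > 0 be the unique positive solution of h = k·f_θ(h), and set ᾱ = e^{−2·β·J}, F(x) = (x + ᾱ)/(1 + ᾱ·x), 𝒥(x) = F(x)^k. Then x₀ = e^{2·h₀} is an attracting fixed point of 𝒥: 𝒥(x₀) = x₀ and 𝒥'(x₀) < 1. -/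
/-- For `θ = tanh(βJ) > 1/k` and `h₀ > 0` the unique positive solution of
`h = k f_θ(h)`, the point `x₀ = e^{2h₀}` is an attracting fixed point of
`𝒥(x) = F(x)^k`: `𝒥(x₀) = x₀` and `𝒥'(x₀) < 1`. -/
theorem J_attracting_fixed_point (β J : ℝ) (hβ : 0 < β) (hJ : 0 < J)
    (k : ℕ) (hk : 2 ≤ k)
    (θ : ℝ) (hθ : θ = Real.tanh (β * J)) (hθk : θ > 1 / (k : ℝ))
    (h₀ : ℝ) (hh₀pos : 0 < h₀) (hh₀eq : h₀ = (k : ℝ) * isingF θ h₀)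
    (hh₀uniq : ∀ h : ℝ, 0 < h → h = (k : ℝ) * isingF θ h → h = h₀)
    (ᾱ : ℝ) (hᾱ : ᾱ = Real.exp (-(2 * β * J)))
    (F 𝒥 : ℝ → ℝ) (hF : ∀ x : ℝ, F x = (x + ᾱ) / (1 + ᾱ * x))
    (h𝒥 : ∀ x : ℝ, 𝒥 x = (F x) ^ k) :
    𝒥 (Real.exp (2 * h₀)) = Real.exp (2 * h₀) ∧
    deriv 𝒥 (Real.exp (2 * h₀)) < 1 := by
  have ha0 : 0 < ᾱ := hᾱ ▸ Real.exp_pos _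
  have ha1 : ᾱ < 1 := by
    rw [hᾱ, Real.exp_lt_one_iff]
    have := mul_pos hβ hJ
    linarith
  have tanh_form : ∀ y : ℝ, Real.tanh y = (Real.exp (2 * y) - 1) / (Real.exp (2 * y) + 1) := by
    intro y
    have h1 := Real.exp_pos y
    rw [Real.tanh_eq, Real.exp_neg, two_mul, Real.exp_add]
    field_simp
  have hθa : θ = (1 - ᾱ) / (1 + ᾱ) := by
    have h1 := Real.exp_pos (2 * (β * J))
    rw [hθ, hᾱ, tanh_form, Real.exp_neg, show 2 * β * J = 2 * (β * J) by ring]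
    field_simp
  have hx1 : 1 < Real.exp (2 * h₀) := by
    rw [Real.one_lt_exp_iff]; linarith
  have hlogx : Real.log (Real.exp (2 * h₀)) = 2 * h₀ := Real.log_exp _
  have ht := tanh_form h₀
  generalize Real.exp (2 * h₀) = x at *
  have hx0 : 0 < x := by linarith
  have hFpos : ∀ y : ℝ, 0 < y → 0 < (y + ᾱ) / (1 + ᾱ * y) := fun y hy => by positivity
  have hkey : Real.log x = k * Real.log ((x + ᾱ) / (1 + ᾱ * x)) := by
    have h2 : (1 + θ * Real.tanh h₀) / (1 - θ * Real.tanh h₀) = (x + ᾱ) / (1 + ᾱ * x) := by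
      have e1 : 1 + θ * Real.tanh h₀ = 2 * (x + ᾱ) / ((1 + ᾱ) * (x + 1)) := by
        rw [hθa, ht]; field_simp; ring
      have e2 : 1 - θ * Real.tanh h₀ = 2 * (1 + ᾱ * x) / ((1 + ᾱ) * (x + 1)) := by
        rw [hθa, ht]; field_simp; ring
      rw [e1, e2]; field_simp
    unfold isingF artanh at hh₀eq
    rw [h2] at hh₀eq
    rw [hlogx]
    linarith
  have hfix : ((x + ᾱ) / (1 + ᾱ * x)) ^ k = x := by
    apply Real.log_injOn_pos (Set.mem_Ioi.2 (pow_pos (hFpos x hx0) k)) (Set.mem_Ioi.2 hx0)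
    rw [Real.log_pow, hkey]
  have hFder : ∀ y : ℝ, 0 < y →
      HasDerivAt (fun y : ℝ => (y + ᾱ) / (1 + ᾱ * y)) ((1 - ᾱ ^ 2) / (1 + ᾱ * y) ^ 2) y := by
    intro y hy
    have hne : 1 + ᾱ * y ≠ 0 := by positivity
    have := ((hasDerivAt_id y).add_const ᾱ).div
      (((hasDerivAt_id y).const_mul ᾱ).const_add 1) hne
    refine this.congr_deriv ?_
    simp only [id]
    congr 1
    ring
  have hlogder : ∀ y : ℝ, 0 < y →
      HasDerivAt (fun y : ℝ => Real.log ((y + ᾱ) / (1 + ᾱ * y)))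
        ((1 - ᾱ ^ 2) / ((y + ᾱ) * (1 + ᾱ * y))) y := by
    intro y hy
    refine ((hFder y hy).log (hFpos y hy).ne').congr_deriv ?_
    field_simp
  refine ⟨by rw [h𝒥, hF, hfix], ?_⟩
  obtain ⟨c, ⟨hc1, hcx⟩, hc⟩ := exists_ratio_hasDerivAt_eq_ratio_slope
    (fun y : ℝ => Real.log ((y + ᾱ) / (1 + ᾱ * y)))
    (fun y => (1 - ᾱ ^ 2) / ((y + ᾱ) * (1 + ᾱ * y))) hx1
    (fun y hy => (hlogder y (by linarith [hy.1])).continuousAt.continuousWithinAt)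
    (fun y hy => hlogder y (by linarith [hy.1]))
    Real.log (fun y => y⁻¹)
    (fun y hy => (Real.continuousAt_log (by linarith [hy.1])).continuousWithinAt)
    (fun y hy => Real.hasDerivAt_log (by linarith [hy.1]))
  have hc0 : 0 < c := by linarith
  have hone : (1 + ᾱ) / (1 + ᾱ * 1) = 1 := by rw [mul_one]; exact div_self (by positivity)
  simp only [hone, Real.log_one, sub_zero] at hc
  have hlogpos : 0 < Real.log x := Real.log_pos hx1
  have hkpos : (0 : ℝ) < k := by exact_mod_cast (by omega : 0 < k)
  have hkc : (k : ℝ) * (c * (1 - ᾱ ^ 2) / ((c + ᾱ) * (1 + ᾱ * c))) = 1 := by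
    have h3 : Real.log x * ((k : ℝ) * (c * (1 - ᾱ ^ 2) / ((c + ᾱ) * (1 + ᾱ * c))))
        = Real.log x * 1 := by
      calc _ = k * c * (Real.log x * ((1 - ᾱ ^ 2) / ((c + ᾱ) * (1 + ᾱ * c)))) := by ring
        _ = k * c * (Real.log ((x + ᾱ) / (1 + ᾱ * x)) * c⁻¹) := by rw [hc]
        _ = k * Real.log ((x + ᾱ) / (1 + ᾱ * x)) * (c * c⁻¹) := by ring
        _ = _ := by rw [← hkey, mul_inv_cancel₀ hc0.ne']
    exact mul_left_cancel₀ hlogpos.ne' h3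
  have hb : 0 < 1 - ᾱ ^ 2 := by nlinarith
  have hlt : x * (1 - ᾱ ^ 2) / ((x + ᾱ) * (1 + ᾱ * x))
      < c * (1 - ᾱ ^ 2) / ((c + ᾱ) * (1 + ᾱ * c)) := by
    rw [div_lt_div_iff₀ (by positivity) (by positivity)]
    have h4 : 0 < (1 - ᾱ ^ 2) * (ᾱ * ((x - c) * (c * x - 1))) := by
      refine mul_pos hb (mul_pos ha0 (mul_pos (by linarith) (by nlinarith)))
    nlinarith [h4]
  have h𝒥' : 𝒥 = fun y => ((y + ᾱ) / (1 + ᾱ * y)) ^ k := by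
    funext y; rw [h𝒥, hF]
  have hd := (hFder x hx0).fun_pow k
  rw [h𝒥', hd.deriv]
  have hpow : ((x + ᾱ) / (1 + ᾱ * x)) ^ (k - 1) = x / ((x + ᾱ) / (1 + ᾱ * x)) := by
    rw [eq_div_iff (hFpos x hx0).ne', ← pow_succ, Nat.sub_add_cancel (by omega), hfix]
  rw [hpow]
  calc _ = (k : ℝ) * (x * (1 - ᾱ ^ 2) / ((x + ᾱ) * (1 + ᾱ * x))) := by field_simp
    _ < (k : ℝ) * (c * (1 - ᾱ ^ 2) / ((c + ᾱ) * (1 + ᾱ * c))) := mul_lt_mul_of_pos_left hlt hkpos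
    _ = 1 := hkc
end

section
/- Let β > 0, J > 0, k ≥ 2 an integer, θ = tanh(β·J), and suppose θ > 1/k. Let h₀ > 0 be the unique positive solution of h = k·f_θ(h). Then K_β(e^{2·h₀}) < 1/k, where K_β(x) = 1/(e^{−2·β·J}·x + 1) − 1/(e^{2·β·J}·x + 1). -/
lemma isingF_aux (b h : ℝ) :
    isingF (Real.tanh b) h
      = (1 / 2) * (Real.log (Real.cosh (b + h)) - Real.log (Real.cosh (b - h))) := by
  unfold isingF artanh
  have h1 := Real.cosh_pos (b + h)
  have h2 := Real.cosh_pos (b - h)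
  have h3 := Real.cosh_pos b
  have h4 := Real.cosh_pos h
  rw [← Real.log_div h1.ne' h2.ne']
  congr 2
  have e1 : 1 + Real.tanh b * Real.tanh h
      = Real.cosh (b + h) / (Real.cosh b * Real.cosh h) := by
    rw [Real.cosh_add, Real.tanh_eq_sinh_div_cosh, Real.tanh_eq_sinh_div_cosh]
    field_simp
  have e2 : 1 - Real.tanh b * Real.tanh h
      = Real.cosh (b - h) / (Real.cosh b * Real.cosh h) := by
    rw [Real.cosh_sub, Real.tanh_eq_sinh_div_cosh, Real.tanh_eq_sinh_div_cosh]
    field_simp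
  rw [e1, e2]
  field_simp

lemma cosh_mul_aux (b h : ℝ) :
    2 * (Real.cosh (b + h) * Real.cosh (b - h)) = Real.cosh (2 * b) + Real.cosh (2 * h) := by
  have e1 : 2 * b = (b + h) + (b - h) := by ring
  have e2 : 2 * h = (b + h) - (b - h) := by ring
  rw [e1, e2, Real.cosh_add (b + h), Real.cosh_sub (b + h)]
  ring

lemma deriv_aux (b h : ℝ) :
    HasDerivAt (fun h => (1 / 2) *
      (Real.log (Real.cosh (b + h)) - Real.log (Real.cosh (b - h))))
      (Real.sinh (2 * b) / (Real.cosh (2 * b) + Real.cosh (2 * h))) h := by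
  have h1 := Real.cosh_pos (b + h)
  have h2 := Real.cosh_pos (b - h)
  have d1 : HasDerivAt (fun h => b + h) 1 h := (hasDerivAt_id h).const_add b
  have d2 : HasDerivAt (fun h => b - h) (-1) h := (hasDerivAt_id h).const_sub b
  have d := ((d1.cosh.log h1.ne').sub (d2.cosh.log h2.ne')).const_mul (1 / 2 : ℝ)
  refine d.congr_deriv ?_
  rw [← cosh_mul_aux]
  have e1 : 2 * b = (b + h) + (b - h) := by ring
  rw [e1, Real.sinh_add (b + h)]
  field_simp
  ring

lemma K_aux (b h : ℝ) :
    1 / (Real.exp (-(2 * b)) * Real.exp (2 * h) + 1)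
      - 1 / (Real.exp (2 * b) * Real.exp (2 * h) + 1)
      = Real.sinh (2 * b) / (Real.cosh (2 * b) + Real.cosh (2 * h)) := by
  rw [Real.sinh_eq, Real.cosh_eq, Real.cosh_eq, Real.exp_neg, Real.exp_neg]
  have h1 := Real.exp_pos (2 * b)
  have h2 := Real.exp_pos (2 * h)
  generalize Real.exp (2 * b) = A at *
  generalize Real.exp (2 * h) = X at *
  have e : (A + A⁻¹) / 2 + (X + X⁻¹) / 2 = (A⁻¹ * X + 1) * (A * X + 1) / (2 * X) := by
    field_simp
    ring
  rw [e]
  have : 0 < A⁻¹ * X + 1 := by positivity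
  have : 0 < A * X + 1 := by positivity
  rw [div_sub_div _ _ (by positivity) (by positivity), div_div_eq_mul_div]
  congr 1
  ring

/-- For `θ = tanh(βJ) > 1/k` and `h₀ > 0` the unique positive solution of
`h = k f_θ(h)`: `K_β(e^{2h₀}) < 1/k`. -/
theorem K_beta_lt_inv_k (β J : ℝ) (hβ : 0 < β) (hJ : 0 < J)
    (k : ℕ) (hk : 2 ≤ k)
    (θ : ℝ) (hθ : θ = Real.tanh (β * J)) (hθk : θ > 1 / (k : ℝ))
    (h₀ : ℝ) (hh₀pos : 0 < h₀) (hh₀eq : h₀ = (k : ℝ) * isingF θ h₀)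
    (hh₀uniq : ∀ h : ℝ, 0 < h → h = (k : ℝ) * isingF θ h → h = h₀)
    (K : ℝ → ℝ)
    (hK : ∀ x : ℝ, K x =
      1 / (Real.exp (-(2 * β * J)) * x + 1) - 1 / (Real.exp (2 * β * J) * x + 1)) :
    K (Real.exp (2 * h₀)) < 1 / (k : ℝ) := by
  have hb : 0 < β * J := mul_pos hβ hJ
  have hk0 : (0 : ℝ) < k := by exact_mod_cast (by omega : 0 < k)
  rw [hK, mul_assoc 2 β J, K_aux]
  rw [hθ, isingF_aux] at hh₀eq
  obtain ⟨c, hc, hceq⟩ := exists_hasDerivAt_eq_slope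
    (fun h => (1 / 2) * (Real.log (Real.cosh (β * J + h)) - Real.log (Real.cosh (β * J - h))))
    (fun h => Real.sinh (2 * (β * J)) / (Real.cosh (2 * (β * J)) + Real.cosh (2 * h)))
    hh₀pos (fun x _ => (deriv_aux _ x).continuousAt.continuousWithinAt)
    (fun x _ => deriv_aux _ x)
  have hs : 0 < Real.sinh (2 * (β * J)) := Real.sinh_pos_iff.2 (by positivity)
  have hlt : Real.cosh (2 * c) < Real.cosh (2 * h₀) := by
    rw [Real.cosh_lt_cosh, abs_of_pos (by linarith [hc.1]), abs_of_pos (by linarith)]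
    linarith [hc.2]
  have hpos := Real.cosh_pos (2 * c)
  have hpos2 := Real.cosh_pos (2 * (β * J))
  have step : Real.sinh (2 * (β * J)) / (Real.cosh (2 * (β * J)) + Real.cosh (2 * h₀))
      < Real.sinh (2 * (β * J)) / (Real.cosh (2 * (β * J)) + Real.cosh (2 * c)) :=
    div_lt_div_of_pos_left hs (by linarith) (by linarith)
  refine step.trans_eq (hceq.trans ?_)
  simp only [add_zero, sub_zero, sub_self, mul_zero]
  rw [div_eq_div_iff hh₀pos.ne' hk0.ne']
  linarith
end
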